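/- Let f be a smooth function on a dilation-invariant open set U ⊆ ℝ^N, homogeneous of degree w ∈ ℝ. Then Σ_{i=1}^N Dᵢ(xᵢ·f) = (n + 2w + 2)(n + w)·f − Q·Δf on U. (This is the flat scalar form of the paper's identity D̃_A X^A V = (n + 2w + 2)(n + w)V − QΔ̃V, which on restriction to the cone gives the tractor identity D_A X^A V = (n + 2w + 2)(n + w)V.) -/

import Mathlib

noncomputable section

open scoped BigOperators

/-- The `i`-th partial derivative of a function on `ℝ^N`. -/
def pderiv' {N : ℕ} (i : Fin N) (f : (Fin N → ℝ) → ℝ) : (Fin N → ℝ) → ℝ :=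
  fun x => fderiv ℝ f x (Pi.single i 1)

/-- The flat pseudo-Laplacian `Δf = ∑ i, εᵢ ∂²f/∂xᵢ²` with signs `ε`. -/
def lapE {N : ℕ} (ε : Fin N → ℝ) (f : (Fin N → ℝ) → ℝ) : (Fin N → ℝ) → ℝ :=
  fun x => ∑ i, ε i * pderiv' i (pderiv' i f) x

/-- The Euler operator `(Ef)(x) = ∑ i, xᵢ ∂f/∂xᵢ (x)`. -/
def eulerOp {N : ℕ} (f : (Fin N → ℝ) → ℝ) : (Fin N → ℝ) → ℝ :=
  fun x => ∑ i, x i * pderiv' i f x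

/-- The quadratic form `Q(x) = ∑ i, εᵢ xᵢ²`. -/
def Qform {N : ℕ} (ε : Fin N → ℝ) : (Fin N → ℝ) → ℝ :=
  fun x => ∑ i, ε i * (x i) ^ 2

/-- An open set `U ⊆ ℝ^N` is dilation-invariant if `t • x ∈ U` for `x ∈ U`, `t > 0`. -/
def DilationInvariant {N : ℕ} (U : Set (Fin N → ℝ)) : Prop :=
  ∀ x ∈ U, ∀ t : ℝ, 0 < t → t • x ∈ U

/-- `f` is homogeneous of degree `w` on `U`: `f(t • x) = t^w f(x)` for `x ∈ U`, `t > 0`. -/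
def HomogeneousOn {N : ℕ} (f : (Fin N → ℝ) → ℝ) (w : ℝ) (U : Set (Fin N → ℝ)) : Prop :=
  ∀ x ∈ U, ∀ t : ℝ, 0 < t → f (t • x) = t ^ w * f x

/-- The `i`-th component of the flat tractor-D operator:
`Dᵢ f = ∂ᵢ((n + 2E − 2) f) − εᵢ xᵢ Δf`. -/
def Dop {N : ℕ} (n : ℕ) (ε : Fin N → ℝ) (i : Fin N) (f : (Fin N → ℝ) → ℝ) :
    (Fin N → ℝ) → ℝ :=
  fun x => pderiv' i (fun y => (n : ℝ) * f y + 2 * eulerOp f y - 2 * f y) x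
    - ε i * x i * lapE ε f x

theorem pd_mul {N : ℕ} (i j : Fin N) (f : (Fin N → ℝ) → ℝ) (x : Fin N → ℝ)
    (hf : DifferentiableAt ℝ f x) :
    pderiv' j (fun y => y i * f y) x
      = (if i = j then 1 else 0) * f x + x i * pderiv' j f x := by
  have h1 : HasFDerivAt (fun y : Fin N → ℝ => y i)
      (ContinuousLinearMap.proj (R := ℝ) (φ := fun _ : Fin N => ℝ) i) x :=
    hasFDerivAt_apply i x
  have h2 := (h1.mul hf.hasFDerivAt).fderiv
  unfold pderiv'
  have h3 : fderiv ℝ (fun y : Fin N → ℝ => y i * f y) x = _ := h2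
  rw [h3]
  simp [Pi.single_apply]
  ring

theorem pd_congr {N : ℕ} (j : Fin N) {f g : (Fin N → ℝ) → ℝ} {U : Set (Fin N → ℝ)}
    (hU : IsOpen U) (h : ∀ y ∈ U, f y = g y) {x : Fin N → ℝ} (hx : x ∈ U) :
    pderiv' j f x = pderiv' j g x := by
  unfold pderiv'
  have : f =ᶠ[nhds x] g := Filter.eventuallyEq_of_mem (hU.mem_nhds hx) h
  rw [this.fderiv_eq]

theorem euler_hom {N : ℕ} (f : (Fin N → ℝ) → ℝ) (x : Fin N → ℝ) (w : ℝ)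
    (hf : DifferentiableAt ℝ f x)
    (hw : ∀ t : ℝ, 0 < t → f (t • x) = t ^ w * f x) :
    eulerOp f x = w * f x := by
  have h0 : eulerOp f x = fderiv ℝ f x x := by
    unfold eulerOp pderiv'
    have hL : ∀ L : (Fin N → ℝ) →L[ℝ] ℝ, ∑ i, x i * L (Pi.single i 1) = L x := by
      intro L
      conv_rhs => rw [pi_eq_sum_univ' x, map_sum]
      refine Finset.sum_congr rfl fun i _ => ?_
      rw [map_smul, smul_eq_mul]
    exact hL _
  have h1 : HasDerivAt (fun t : ℝ => t • x) x 1 := by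
    simpa using (hasDerivAt_id (1 : ℝ)).smul_const x
  have hf' : HasFDerivAt f (fderiv ℝ f x) ((1 : ℝ) • x) := by
    rw [one_smul]; exact hf.hasFDerivAt
  have h2 : HasDerivAt (fun t : ℝ => f (t • x)) (fderiv ℝ f x x) 1 :=
    hf'.comp_hasDerivAt (1 : ℝ) h1
  have h3 : HasDerivAt (fun t : ℝ => t ^ w * f x) (w * f x) 1 := by
    simpa using (Real.hasDerivAt_rpow_const (x := 1) (p := w) (Or.inl one_ne_zero)).mul_const (f x)
  have h4 : (fun t : ℝ => f (t • x)) =ᶠ[nhds 1] (fun t : ℝ => t ^ w * f x) :=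
    Filter.eventuallyEq_of_mem (Ioi_mem_nhds one_pos) (fun t ht => hw t ht)
  rw [h0]
  exact h2.unique (h3.congr_of_eventuallyEq h4)

/-- Flat scalar form of `D_A X^A V = (n + 2w + 2)(n + w)V − QΔV` on functions
homogeneous of degree `w`. -/
theorem Dop_X_identity (n : ℕ) (hn : 1 ≤ n) (ε : Fin (n + 2) → ℝ)
    (hε : ∀ i, ε i = 1 ∨ ε i = -1)
    (U : Set (Fin (n + 2) → ℝ)) (hU : IsOpen U) (hUdil : DilationInvariant U)
    (f : (Fin (n + 2) → ℝ) → ℝ) (hf : ContDiffOn ℝ (⊤ : ℕ∞) f U)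
    (w : ℝ) (hw : HomogeneousOn f w U) :
    ∀ x ∈ U,
      (∑ i : Fin (n + 2), Dop n ε i (fun y => y i * f y) x)
        = ((n : ℝ) + 2 * w + 2) * ((n : ℝ) + w) * f x - Qform ε x * lapE ε f x := by
  intro x hx
  have hd : ∀ y ∈ U, DifferentiableAt ℝ f y := fun y hy =>
    (hf.contDiffAt (hU.mem_nhds hy)).differentiableAt (by simp)
  have hdp : ∀ j, ∀ y ∈ U, DifferentiableAt ℝ (pderiv' j f) y := fun j y hy => by
    have h1 : ContDiffAt ℝ 1 (fderiv ℝ f) y :=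
      (hf.contDiffAt (hU.mem_nhds hy)).fderiv_right (m := 1) (by
        norm_cast)
    exact (h1.differentiableAt (by simp)).clm_apply (differentiableAt_const _)
  have hE : ∀ y ∈ U, eulerOp f y = w * f y := fun y hy =>
    euler_hom f y w (hd y hy) (hw y hy)
  have hEg : ∀ i, ∀ y ∈ U, eulerOp (fun y => y i * f y) y = (w + 1) * (y i * f y) := by
    intro i y hy
    have h : eulerOp (fun y => y i * f y) y = y i * f y + y i * eulerOp f y := by
      unfold eulerOp
      simp_rw [pd_mul i _ f y (hd y hy), mul_add, Finset.sum_add_distrib, Finset.mul_sum]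
      congr 1
      · simp
      · exact Finset.sum_congr rfl fun j _ => by ring
    rw [h, hE y hy]; ring
  have hlap : ∀ i, lapE ε (fun y => y i * f y) x
      = x i * lapE ε f x + 2 * ε i * pderiv' i f x := by
    intro i
    have h : ∀ j, pderiv' j (pderiv' j (fun y => y i * f y)) x
        = 2 * ((if i = j then 1 else 0) * pderiv' j f x)
          + x i * pderiv' j (pderiv' j f) x := by
      intro j
      rw [pd_congr j hU (fun y hy => pd_mul i j f y (hd y hy)) hx]
      have hs : pderiv' j (fun y => (if i = j then 1 else 0) * f y + y i * pderiv' j f y) x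
          = (if i = j then 1 else 0) * pderiv' j f x
            + pderiv' j (fun y => y i * pderiv' j f y) x := by
        have hm : DifferentiableAt ℝ (fun y => y i * pderiv' j f y) x :=
          (differentiableAt_apply i x).mul (hdp j x hx)
        unfold pderiv' at hm ⊢
        rw [fderiv_fun_add ((hd x hx).const_mul _)
          hm, fderiv_const_mul (hd x hx)]
        split_ifs <;> simp
      rw [hs, pd_mul i j _ x (hdp j x hx)]
      ring
    unfold lapE
    simp_rw [h, mul_add, Finset.sum_add_distrib, Finset.mul_sum]
    rw [add_comm]
    congr 1
    · exact Finset.sum_congr rfl fun j _ => by ring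
    · simp; ring
  have hD : ∀ i, Dop n ε i (fun y => y i * f y) x
      = ((n : ℝ) + 2 * w) * (f x + x i * pderiv' i f x)
        - (ε i * x i ^ 2 * lapE ε f x + 2 * (x i * pderiv' i f x)) := by
    intro i
    unfold Dop
    rw [hlap i]
    have h1 : ∀ y ∈ U, (n : ℝ) * (y i * f y) + 2 * eulerOp (fun y => y i * f y) y
        - 2 * (y i * f y) = y i * (((n : ℝ) + 2 * w) * f y) := by
      intro y hy
      rw [hEg i y hy]; ring
    rw [pd_congr i hU h1 hx, pd_mul i i _ x ((hd x hx).const_mul _)]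
    have h2 : pderiv' i (fun y => ((n : ℝ) + 2 * w) * f y) x
        = ((n : ℝ) + 2 * w) * pderiv' i f x := by
      unfold pderiv'
      rw [fderiv_const_mul (hd x hx)]
      simp
    rw [h2]
    have h3 : ε i * ε i = 1 := by rcases hε i with h | h <;> rw [h] <;> norm_num
    simp only [if_true]
    linear_combination (-2 * x i * pderiv' i f x) * h3
  simp_rw [hD, Finset.sum_sub_distrib, Finset.sum_add_distrib, ← Finset.mul_sum,
    Finset.sum_add_distrib, ← Finset.sum_mul]
  have h5 : ∑ i, x i * pderiv' i f x = w * f x := hE x hx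
  rw [h5]
  unfold Qform
  simp
  ring
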